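/- arXiv:2509.03698 — 6 statements merged into one kernel-verified Lean document; each statement's English description precedes it below -/
import Mathlib

section
/- Let L be a maximal isotropic subspace of V × V* and let W ⊆ V be a subspace. Then pr_V(L) + W = V if and only if L ∩ ({0} × W°) = {0}. -/
/-- Let `L` be a maximal isotropic subspace of `V × V*` (with respect to
the symmetric pairing `⟨(x,ξ),(y,η)⟩ = ξ(y) + η(x)`) and let `W ⊆ V` be a subspace.  Then
`pr_V(L) + W = V` if and only if `L ∩ ({0} × W°) = {0}`, the latter being expressed by
saying that any element `(0,η) ∈ L` with `η ∈ W°` satisfies `η = 0`. -/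
theorem stmt2 {V : Type*} [AddCommGroup V] [Module ℝ V] [FiniteDimensional ℝ V]
    (L : Submodule ℝ (V × Module.Dual ℝ V))
    (hL : ∀ p : V × Module.Dual ℝ V,
      p ∈ L ↔ ∀ q ∈ L, p.2 q.1 + q.2 p.1 = 0)
    (W : Submodule ℝ V) :
    L.map (LinearMap.fst ℝ V (Module.Dual ℝ V)) ⊔ W = ⊤ ↔
      (∀ η : Module.Dual ℝ V, ((0 : V), η) ∈ L → (∀ w ∈ W, η w = 0) → η = 0) := by
  have mem_iff (η : Module.Dual ℝ V) : ((0 : V), η) ∈ L ↔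
      η ∈ (L.map (LinearMap.fst ℝ V (Module.Dual ℝ V))).dualAnnihilator := by
    rw [hL, Submodule.mem_dualAnnihilator]
    simp
  rw [← Submodule.dualAnnihilator_eq_bot_iff, Submodule.dualAnnihilator_sup_eq,
    Submodule.eq_bot_iff]
  simp only [mem_iff, Submodule.mem_inf, and_imp, Submodule.mem_dualAnnihilator]
end

section
/- Let F : U → V be a linear map and let L be a maximal isotropic subspace of V × V* satisfying the transversality condition pr_V(L) + range(F) = V. Then the linear map φ : L → V × U*, (v,η) ↦ (v, F*η), is injective, where F* : V* → U* is the dual map of F. -/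
/-- Let `F : U → V` be a linear map between finite-dimensional real vector
spaces and let `L` be a maximal isotropic subspace of `V × V*` (with respect to the pairing
`⟨(x,ξ),(y,η)⟩ = ξ(y) + η(x)`) satisfying the transversality condition
`pr_V(L) + range F = V`.  Then the linear map `φ : L → V × U*, (v,η) ↦ (v, F*η)` is
injective, where `F*` denotes the dual map of `F`. -/
theorem stmt3 {U V : Type*} [AddCommGroup U] [Module ℝ U] [FiniteDimensional ℝ U]
    [AddCommGroup V] [Module ℝ V] [FiniteDimensional ℝ V]
    (F : U →ₗ[ℝ] V)
    (L : Submodule ℝ (V × Module.Dual ℝ V))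
    (hL : ∀ p : V × Module.Dual ℝ V,
      p ∈ L ↔ ∀ q ∈ L, p.2 q.1 + q.2 p.1 = 0)
    (htrans : L.map (LinearMap.fst ℝ V (Module.Dual ℝ V)) ⊔ LinearMap.range F = ⊤) :
    Function.Injective (fun p : L =>
      (((p : V × Module.Dual ℝ V).1, F.dualMap (p : V × Module.Dual ℝ V).2) :
        V × Module.Dual ℝ U)) := by
  intro p q hpq
  obtain ⟨hfst, hdual⟩ := Prod.mk.inj hpq
  have hsub := L.sub_mem p.2 q.2
  refine Subtype.ext (Prod.ext hfst (LinearMap.ext fun v => ?_))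
  have hv : v ∈ L.map (LinearMap.fst ℝ V (Module.Dual ℝ V)) ⊔ LinearMap.range F :=
    htrans ▸ Submodule.mem_top
  obtain ⟨_, ⟨r, hr, rfl⟩, _, ⟨u, rfl⟩, rfl⟩ := Submodule.mem_sup.mp hv
  have hiso := (hL _).mp hsub r hr
  have hu : (p : V × Module.Dual ℝ V).2 (F u) = (q : V × Module.Dual ℝ V).2 (F u) :=
    LinearMap.congr_fun hdual u
  simp only [Prod.fst_sub, Prod.snd_sub, hfst, sub_self, map_zero, add_zero,
    LinearMap.sub_apply, sub_eq_zero] at hiso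
  simp only [map_add, LinearMap.fst_apply, hiso, hu]
end

section
/- Let F : U → V be any linear map and L any maximal isotropic subspace of V × V*. Then the backward image B_F(L) := {(u, F*η) ∈ U × U* : u ∈ U, η ∈ V*, (F u, η) ∈ L} is a maximal isotropic subspace of U × U* (with respect to the analogous pairing on U × U*). -/
/-- Let `F : U → V` be any linear map between finite-dimensional real
vector spaces and `L` any maximal isotropic subspace of `V × V*` (with respect to the
pairing `⟨(x,ξ),(y,η)⟩ = ξ(y) + η(x)`; maximal isotropic means that `L` equals its own
orthogonal complement).  Then the backward image
`B_F(L) = {(u, F*η) : (F u, η) ∈ L}` is a maximal isotropic subspace of `U × U*`, i.e. it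
coincides with its own orthogonal complement with respect to the analogous pairing on
`U × U*` (in particular it is a linear subspace). -/
theorem stmt4 {U V : Type*} [AddCommGroup U] [Module ℝ U] [FiniteDimensional ℝ U]
    [AddCommGroup V] [Module ℝ V] [FiniteDimensional ℝ V]
    (F : U →ₗ[ℝ] V)
    (L : Submodule ℝ (V × Module.Dual ℝ V))
    (hL : ∀ p : V × Module.Dual ℝ V,
      p ∈ L ↔ ∀ q ∈ L, p.2 q.1 + q.2 p.1 = 0) :
    ∀ p : U × Module.Dual ℝ U,
      (∃ η : Module.Dual ℝ V, (F p.1, η) ∈ L ∧ p.2 = F.dualMap η) ↔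
      ∀ q : U × Module.Dual ℝ U,
        (∃ η : Module.Dual ℝ V, (F q.1, η) ∈ L ∧ q.2 = F.dualMap η) →
        p.2 q.1 + q.2 p.1 = 0 := by
  rintro ⟨u, α⟩
  constructor
  · rintro ⟨η, hη, hα⟩ ⟨w, β⟩ ⟨ζ, hζ, hβ⟩
    dsimp only at hα hβ
    subst hα hβ
    exact (hL _).1 hη _ hζ
  · intro h
    -- `η` comes from factoring `φ (w, l) = α w + l.2 (F u)` through `T (w, l) = F w - l.1`.
    let T : U × L →ₗ[ℝ] V :=
      F.coprod (-(LinearMap.fst ℝ V (Module.Dual ℝ V) ∘ₗ L.subtype))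
    let φ : Module.Dual ℝ (U × L) :=
      α.coprod (Module.Dual.eval ℝ V (F u) ∘ₗ LinearMap.snd ℝ V (Module.Dual ℝ V) ∘ₗ L.subtype)
    have hφ : φ ∈ LinearMap.range T.dualMap := by
      rw [LinearMap.range_dualMap_eq_dualAnnihilator_ker (K := ℝ) (V₁ := U × L) T, Submodule.mem_dualAnnihilator]
      rintro ⟨w, ⟨⟨v, ζ⟩, hl⟩⟩ hker
      have hv : F w = v := by
        simpa [T, ← sub_eq_add_neg, sub_eq_zero] using hker
      subst hv
      simpa [φ] using h (w, F.dualMap ζ) ⟨ζ, hl, rfl⟩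
    obtain ⟨η, hη⟩ := hφ
    refine ⟨η, (hL _).2 fun q hq => ?_, LinearMap.ext fun w => ?_⟩
    · have := LinearMap.congr_fun hη (0, ⟨q, hq⟩)
      simp only [T, φ, LinearMap.dualMap_apply, LinearMap.coprod_apply, map_zero, zero_add,
        LinearMap.neg_apply, LinearMap.comp_apply, Submodule.subtype_apply, LinearMap.fst_apply,
        LinearMap.snd_apply, map_neg, Module.Dual.eval_apply] at this
      dsimp only
      linarith
    · simpa [T, φ] using (LinearMap.congr_fun hη (w, 0)).symm
end

section
/- Let F : U → V be a linear map and let L be a maximal isotropic subspace of V × V* satisfying pr_V(L) + range(F) = V. Then the pullback F^!L := {((v,η), u) ∈ (V × V*) × U : (v,η) ∈ L and v = F u} has dimension equal to dim U. -/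
/-- A subspace of `V × V*` that equals its orthogonal complement for the pairing
`⟨(x, ξ), (y, η)⟩ = ξ y + η x` has dimension `dim V`. -/
theorem finrank_eq_of_maximalIsotropic {V : Type*} [AddCommGroup V] [Module ℝ V]
    [FiniteDimensional ℝ V] (L : Submodule ℝ (V × Module.Dual ℝ V))
    (hL : ∀ p : V × Module.Dual ℝ V, p ∈ L ↔ ∀ q ∈ L, p.2 q.1 + q.2 p.1 = 0) :
    Module.finrank ℝ L = Module.finrank ℝ V := by
  have hker : (LinearMap.ker ((LinearMap.fst ℝ V (Module.Dual ℝ V)).domRestrict L)).map L.subtype =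
      (L.map (LinearMap.fst ℝ V (Module.Dual ℝ V))).dualAnnihilator.map
        (LinearMap.inr ℝ V (Module.Dual ℝ V)) := by
    ext ⟨x, ξ⟩
    simp only [Submodule.mem_map, Submodule.mem_dualAnnihilator, LinearMap.mem_ker]
    constructor
    · rintro ⟨⟨⟨y, η⟩, hy⟩, h0, h⟩
      obtain ⟨rfl, rfl⟩ := Prod.mk.inj h
      obtain rfl : y = 0 := h0
      refine ⟨η, ?_, rfl⟩
      rintro w ⟨q, hq, rfl⟩
      simpa using (hL _).1 hy q hq
    · rintro ⟨η, hη, h⟩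
      obtain ⟨rfl, rfl⟩ := Prod.mk.inj h
      refine ⟨⟨(0, η), (hL _).2 fun q hq => ?_⟩, rfl, rfl⟩
      simpa using hη q.1 ⟨q, hq, rfl⟩
  have hdim := congrArg (fun W : Submodule ℝ (V × Module.Dual ℝ V) => Module.finrank ℝ W) hker
  beta_reduce at hdim
  rw [← (Submodule.equivMapOfInjective _ L.injective_subtype _).finrank_eq,
    ← (Submodule.equivMapOfInjective _ LinearMap.inr_injective _).finrank_eq] at hdim
  have hrn := LinearMap.finrank_range_add_finrank_ker (K := ℝ) (V := L)
    ((LinearMap.fst ℝ V (Module.Dual ℝ V)).domRestrict L)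
  rw [LinearMap.range_domRestrict, hdim] at hrn
  rw [← hrn, Subspace.finrank_add_finrank_dualAnnihilator_eq]

/-- Let `F : U → V` be a linear map between finite-dimensional real
vector spaces and let `L` be a maximal isotropic subspace of `V × V*` (with respect to the
pairing `⟨(x,ξ),(y,η)⟩ = ξ(y) + η(x)`) satisfying `pr_V(L) + range F = V`.  Then the
pullback `F^!L = {((v,η),u) : (v,η) ∈ L, v = F u}`, a subspace of `(V × V*) × U`, has
dimension equal to `dim U`. -/
theorem stmt5 {U V : Type*} [AddCommGroup U] [Module ℝ U] [FiniteDimensional ℝ U]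
    [AddCommGroup V] [Module ℝ V] [FiniteDimensional ℝ V]
    (F : U →ₗ[ℝ] V)
    (L : Submodule ℝ (V × Module.Dual ℝ V))
    (hL : ∀ p : V × Module.Dual ℝ V,
      p ∈ L ↔ ∀ q ∈ L, p.2 q.1 + q.2 p.1 = 0)
    (htrans : L.map (LinearMap.fst ℝ V (Module.Dual ℝ V)) ⊔ LinearMap.range F = ⊤)
    (S : Submodule ℝ ((V × Module.Dual ℝ V) × U))
    (hS : ∀ p : (V × Module.Dual ℝ V) × U, p ∈ S ↔ p.1 ∈ L ∧ p.1.1 = F p.2) :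
    Module.finrank ℝ S = Module.finrank ℝ U := by
  let g : L × U →ₗ[ℝ] V :=
    ((LinearMap.fst ℝ V (Module.Dual ℝ V)).domRestrict L).coprod (-F)
  let i : L × U →ₗ[ℝ] (V × Module.Dual ℝ V) × U := L.subtype.prodMap LinearMap.id
  have hi : Function.Injective i := L.injective_subtype.prodMap Function.injective_id
  have hS_eq : (LinearMap.ker g).map i = S := by
    ext ⟨p, u⟩
    rw [hS, Submodule.mem_map]
    constructor
    · rintro ⟨⟨l, v⟩, hlv, h⟩
      obtain ⟨rfl, rfl⟩ := Prod.mk.inj h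
      exact ⟨l.2, by simpa [g, add_neg_eq_zero] using hlv⟩
    · rintro ⟨hp, h⟩
      exact ⟨(⟨p, hp⟩, u), by simpa [g, add_neg_eq_zero] using h, rfl⟩
  have hg : LinearMap.range g = ⊤ := by
    rw [LinearMap.range_coprod, LinearMap.range_neg, LinearMap.range_domRestrict, htrans]
  have : Module.Free ℝ L := .of_divisionRing ℝ L
  have hrn := LinearMap.finrank_range_add_finrank_ker (K := ℝ) (V := L × U) g
  rw [hg, finrank_top, Module.finrank_prod, finrank_eq_of_maximalIsotropic L hL,
    (Submodule.equivMapOfInjective i hi _).finrank_eq, hS_eq] at hrn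
  exact Nat.add_left_cancel hrn
end

section
/- Let F : U → V be a linear map and let L be a maximal isotropic subspace of V × V* satisfying pr_V(L) + range(F) = V. Then the linear map ψ : F^!L → U × U*, ((F u, η), u) ↦ (u, F*η), is injective and its image equals the backward image B_F(L) := {(u, F*η) : (F u, η) ∈ L}; in particular ψ is a linear isomorphism from F^!L onto B_F(L). -/
/-- If `L` is isotropic and transverse to `F`, a covector in `L` killed by `F*` vanishes. -/
theorem eq_zero_of_mem_of_dualMap_eq_zero {R U V : Type*} [CommRing R]
    [AddCommGroup U] [Module R U] [AddCommGroup V] [Module R V] {F : U →ₗ[R] V}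
    {L : Submodule R (V × Module.Dual R V)}
    (hL : ∀ p ∈ L, ∀ q ∈ L, p.2 q.1 + q.2 p.1 = 0)
    (htrans : L.map (LinearMap.fst R V (Module.Dual R V)) ⊔ LinearMap.range F = ⊤)
    {θ : Module.Dual R V} (hθ : (0, θ) ∈ L) (hF : F.dualMap θ = 0) : θ = 0 := by
  suffices h : L.map (LinearMap.fst R V (Module.Dual R V)) ⊔ LinearMap.range F ≤
      LinearMap.ker θ from LinearMap.ker_eq_top.mp (top_le_iff.mp (htrans ▸ h))
  refine sup_le ?_ ?_
  · rintro _ ⟨q, hq, rfl⟩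
    simpa using hL _ hθ q hq
  · rintro _ ⟨u, rfl⟩
    exact LinearMap.congr_fun hF u


/-- Let `F : U → V` be a linear map between finite-dimensional real
vector spaces and let `L` be a maximal isotropic subspace of `V × V*` (with respect to the
pairing `⟨(x,ξ),(y,η)⟩ = ξ(y) + η(x)`) satisfying `pr_V(L) + range F = V`.  Let
`S = F^!L = {((v,η),u) : (v,η) ∈ L, v = F u}` be the pullback of `L` along `F` (note that
every element of `S` is of the form `((F u, η), u)`).  Then the linear map
`ψ : F^!L → U × U*, ((F u, η), u) ↦ (u, F*η)` is injective and its image equals the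
backward image `B_F(L) = {(u, F*η) : (F u, η) ∈ L}`; in particular `ψ` is a linear
isomorphism from `F^!L` onto `B_F(L)`. -/
theorem stmt6 {U V : Type*} [AddCommGroup U] [Module ℝ U] [FiniteDimensional ℝ U]
    [AddCommGroup V] [Module ℝ V] [FiniteDimensional ℝ V]
    (F : U →ₗ[ℝ] V)
    (L : Submodule ℝ (V × Module.Dual ℝ V))
    (hL : ∀ p : V × Module.Dual ℝ V,
      p ∈ L ↔ ∀ q ∈ L, p.2 q.1 + q.2 p.1 = 0)
    (htrans : L.map (LinearMap.fst ℝ V (Module.Dual ℝ V)) ⊔ LinearMap.range F = ⊤)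
    (S : Submodule ℝ ((V × Module.Dual ℝ V) × U))
    (hS : ∀ p : (V × Module.Dual ℝ V) × U, p ∈ S ↔ p.1 ∈ L ∧ p.1.1 = F p.2) :
    Function.Injective (fun p : S =>
      (((p : (V × Module.Dual ℝ V) × U).2,
        F.dualMap (p : (V × Module.Dual ℝ V) × U).1.2) : U × Module.Dual ℝ U)) ∧
    Set.range (fun p : S =>
      (((p : (V × Module.Dual ℝ V) × U).2,
        F.dualMap (p : (V × Module.Dual ℝ V) × U).1.2) : U × Module.Dual ℝ U)) =
      {q : U × Module.Dual ℝ U |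
        ∃ η : Module.Dual ℝ V, (F q.1, η) ∈ L ∧ q.2 = F.dualMap η} := by
  constructor
  · rintro ⟨⟨⟨v, η⟩, u⟩, hp⟩ ⟨⟨⟨w, ζ⟩, t⟩, hq⟩ h
    obtain ⟨rfl, hF⟩ : u = t ∧ F.dualMap η = F.dualMap ζ := Prod.ext_iff.mp h
    obtain ⟨hpL, rfl : v = F u⟩ := (hS _).mp hp
    obtain ⟨hqL, rfl : w = F u⟩ := (hS _).mp hq
    have hmem : (0, η - ζ) ∈ L := by simpa using L.sub_mem hpL hqL
    obtain rfl : η = ζ := sub_eq_zero.mp <|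
      eq_zero_of_mem_of_dualMap_eq_zero (fun p hp => (hL p).mp hp) htrans hmem
        (by rw [map_sub, hF, sub_self])
    rfl
  · ext ⟨u, α⟩
    constructor
    · rintro ⟨⟨⟨⟨v, η⟩, t⟩, hp⟩, h⟩
      obtain ⟨rfl, rfl⟩ : t = u ∧ F.dualMap η = α := Prod.ext_iff.mp h
      obtain ⟨hpL, rfl : v = F t⟩ := (hS _).mp hp
      exact ⟨η, hpL, rfl⟩
    · rintro ⟨η, hη, rfl : α = F.dualMap η⟩
      exact ⟨⟨((F u, η), u), (hS _).mpr ⟨hη, rfl⟩⟩, rfl⟩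
end

section
/- The module of smooth functions on ℝ vanishing on the open negative half-line is not locally finitely generated at 0: for every open neighborhood U of 0 in ℝ and every finite family g_1, …, g_k of smooth functions on ℝ vanishing on (−∞,0), there exists a smooth compactly supported function h on ℝ vanishing on (−∞,0) whose restriction to U cannot be written as Σ_j c_j · g_j|_U with c_1, …, c_k smooth functions on U. -/
open Set Filter Topology

/-- A smooth function vanishing on the negative half-line is flat at `0`. -/
theorem exists_abs_le_mul_pow_of_eq_zero_of_neg (n : ℕ) :
    ∀ f : ℝ → ℝ, ContDiff ℝ (⊤ : ℕ∞) f → (∀ x < (0 : ℝ), f x = 0) →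
      ∃ C : ℝ, 0 ≤ C ∧ ∀ x ∈ Icc (0 : ℝ) 1, |f x| ≤ C * x ^ n := by
  induction n with
  | zero =>
    intro f hf _
    obtain ⟨C, hC⟩ := isCompact_Icc.exists_bound_of_continuousOn
      (hf.continuous.continuousOn (s := Icc (0 : ℝ) 1))
    refine ⟨|C|, abs_nonneg C, fun x hx => ?_⟩
    simpa using (hC x hx).trans (le_abs_self C)
  | succ n ih =>
    intro f hf hf0
    have hd : ContDiff ℝ (⊤ : ℕ∞) (deriv f) := (contDiff_infty_iff_deriv.1 hf).2
    have hd0 : ∀ x < (0 : ℝ), deriv f x = 0 := fun x hx => by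
      have : f =ᶠ[𝓝 x] fun _ => (0 : ℝ) := by
        filter_upwards [Iio_mem_nhds hx] with y hy using hf0 y hy
      simp [this.deriv_eq]
    have hz : f 0 = 0 := by
      have h1 : Tendsto f (𝓝[<] (0 : ℝ)) (𝓝 (f 0)) :=
        hf.continuous.continuousAt.tendsto.mono_left nhdsWithin_le_nhds
      have h2 : Tendsto f (𝓝[<] (0 : ℝ)) (𝓝 0) :=
        tendsto_const_nhds.congr' (by
          filter_upwards [self_mem_nhdsWithin] with y hy using (hf0 y hy).symm)
      exact tendsto_nhds_unique h1 h2
    obtain ⟨C, hC0, hC⟩ := ih _ hd hd0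
    refine ⟨C, hC0, fun x hx => ?_⟩
    have key := Convex.norm_image_sub_le_of_norm_deriv_le (𝕜 := ℝ) (f := f) (s := Icc 0 x)
      (C := C * x ^ n) (x := 0) (y := x)
      (fun y _ => (hf.differentiable (by simp)).differentiableAt)
      (fun y hy => (hC y ⟨hy.1, hy.2.trans hx.2⟩).trans
        (mul_le_mul_of_nonneg_left (pow_le_pow_left₀ hy.1 hy.2 n) hC0))
      (convex_Icc _ _) ⟨le_rfl, hx.1⟩ ⟨hx.1, le_rfl⟩
    simpa [hz, abs_of_nonneg hx.1, pow_succ, mul_assoc] using key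

/-- A smooth function of compact support has all derivatives up to a given order bounded by a
common constant. -/
theorem exists_one_le_forall_abs_iteratedDeriv_le {φ : ℝ → ℝ} (hφ : ContDiff ℝ (⊤ : ℕ∞) φ)
    (hc : HasCompactSupport φ) (n : ℕ) :
    ∃ C : ℝ, 1 ≤ C ∧ ∀ k ≤ n, ∀ x, |iteratedDeriv k φ x| ≤ C := by
  have h : ∀ k : ℕ, ∃ C : ℝ, ∀ x, |iteratedDeriv k φ x| ≤ C := fun k => by
    obtain ⟨C, hC⟩ := (hφ.continuous_iteratedFDeriv (m := k)
      (by exact_mod_cast le_top)).bounded_above_of_compact_support (hc.iteratedFDeriv (𝕜 := ℝ) k)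
    exact ⟨C, fun x => by
      simpa [norm_iteratedFDeriv_eq_norm_iteratedDeriv] using hC x⟩
  choose C hC using h
  refine ⟨1 + ∑ k ∈ Finset.range (n + 1), |C k|, ?_, fun k hk x => ?_⟩
  · linarith [Finset.sum_nonneg fun k (_ : k ∈ Finset.range (n + 1)) => abs_nonneg (C k)]
  · have := Finset.single_le_sum (f := fun k => |C k|) (fun k _ => abs_nonneg (C k))
      (Finset.mem_range.2 (Nat.lt_succ_of_le hk))
    linarith [hC k x, le_abs_self (C k)]

/-- A smooth bump function supported in `[1/2, 3/2]` with value `1` at `1`. -/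
theorem exists_smooth_bump_at_one :
    ∃ φ : ℝ → ℝ, ContDiff ℝ (⊤ : ℕ∞) φ ∧ HasCompactSupport φ ∧ (∀ x, 0 ≤ φ x) ∧ φ 1 = 1 ∧
      ∀ x, x ∉ Ioo (1 / 2 : ℝ) (3 / 2) → φ x = 0 := by
  let b : ContDiffBump (1 : ℝ) := ⟨1 / 4, 1 / 2, by norm_num, by norm_num⟩
  refine ⟨b, b.contDiff, b.hasCompactSupport, fun x => b.nonneg,
    b.one_of_mem_closedBall (by simp [b]), fun x hx => ?_⟩
  refine b.zero_of_le_dist ?_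
  by_contra! h
  rw [Real.dist_eq, abs_lt] at h
  have hb : b.rOut = 1 / 2 := rfl
  rw [hb] at h
  exact hx ⟨by linarith [h.1], by linarith [h.2]⟩

/-- For suitable positive coefficients `x n ^ n / (C n * 2 ^ n)`, where `C` does not depend on the
scales `x n`, there is a smooth function on the line, supported in `[0, 2]`, which is at least
that large at `x n`. -/
theorem exists_contDiff_forall_pow_div_le :
    ∃ C : ℕ → ℝ, (∀ n, 1 ≤ C n) ∧ ∀ x : ℕ → ℝ, (∀ n, x n ∈ Ioc (0 : ℝ) 1) →
      ∃ h : ℝ → ℝ, ContDiff ℝ (⊤ : ℕ∞) h ∧ HasCompactSupport h ∧ (∀ y < (0 : ℝ), h y = 0) ∧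
        ∀ n, x n ^ n / (C n * 2 ^ n) ≤ h (x n) := by
  obtain ⟨φ, hφ, hφc, hφ0, hφ1, hφs⟩ := exists_smooth_bump_at_one
  choose C hC1 hC using exists_one_le_forall_abs_iteratedDeriv_le hφ hφc
  refine ⟨C, hC1, fun x hx => ?_⟩
  have hCpos : ∀ n, 0 < C n := fun n => one_pos.trans_le (hC1 n)
  let a : ℕ → ℝ := fun n => x n ^ n / (C n * 2 ^ n)
  have ha : ∀ n, 0 < a n := fun n =>
    div_pos (pow_pos (hx n).1 n) (mul_pos (hCpos n) (by positivity))
  let f : ℕ → ℝ → ℝ := fun n y => a n * φ ((x n)⁻¹ * y)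
  have hf0 : ∀ n y, 0 ≤ f n y := fun n y => mul_nonneg (ha n).le (hφ0 _)
  have hf : ∀ n, ContDiff ℝ (⊤ : ℕ∞) (f n) := fun n =>
    contDiff_const.mul (hφ.comp (contDiff_const.mul contDiff_id))
  have hbound : ∀ n, ∀ k ≤ n, ∀ y, ‖iteratedFDeriv ℝ k (f n) y‖ ≤ (1 / 2 : ℝ) ^ n := by
    intro n k hk y
    have hk' : ContDiff ℝ k φ := hφ.of_le (by exact_mod_cast le_top)
    rw [norm_iteratedFDeriv_eq_norm_iteratedDeriv, iteratedDeriv_const_mul_field,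
      iteratedDeriv_comp_const_mul hk', Real.norm_eq_abs, abs_mul, abs_mul, abs_of_pos (ha n),
      abs_of_pos (pow_pos (inv_pos.2 (hx n).1) k)]
    have hxk : x n ^ n * (x n)⁻¹ ^ k ≤ 1 := by
      rw [inv_pow, ← div_eq_mul_inv, div_le_one (pow_pos (hx n).1 k)]
      exact pow_le_pow_of_le_one (hx n).1.le (hx n).2 hk
    calc a n * ((x n)⁻¹ ^ k * |iteratedDeriv k φ ((x n)⁻¹ * y)|)
        ≤ a n * ((x n)⁻¹ ^ k * C n) := by
          have := hC n k hk ((x n)⁻¹ * y)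
          have h1 := (ha n).le
          have h2 := (pow_pos (inv_pos.2 (hx n).1) k).le
          gcongr
      _ = (x n ^ n * (x n)⁻¹ ^ k) * (1 / 2) ^ n := by
          have := (hCpos n).ne'
          simp only [a, one_div, inv_pow]
          field_simp
      _ ≤ 1 * (1 / 2) ^ n := by gcongr
      _ = (1 / 2) ^ n := one_mul _
  have hgeom : Summable fun n : ℕ => (1 / 2 : ℝ) ^ n := summable_geometric_two
  have hsum : ∀ y, Summable fun n => f n y := fun y =>
    hgeom.of_nonneg_of_le (fun n => hf0 n y) fun n => by
      have := hbound n 0 n.zero_le y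
      rw [norm_iteratedFDeriv_zero] at this
      exact (le_abs_self _).trans this
  have hzero : ∀ y, y ∉ Icc (0 : ℝ) 2 → ∀ n, f n y = 0 := by
    intro y hy n
    have hxn := (hx n).1
    refine mul_eq_zero_of_right _ (hφs _ fun hmem => hy ?_)
    rw [inv_mul_eq_div, mem_Ioo, lt_div_iff₀ hxn, div_lt_iff₀ hxn] at hmem
    exact ⟨by linarith [hmem.1], by linarith [hmem.2, (hx n).2]⟩
  refine ⟨fun y => ∑' n, f n y, ?_, ?_, fun y hy => ?_, fun n => ?_⟩
  · refine contDiff_tsum_of_eventually (v := fun _ n => (1 / 2 : ℝ) ^ n) hf (fun _ _ => hgeom)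
      fun k _ => ?_
    rw [Nat.cofinite_eq_atTop]
    filter_upwards [eventually_ge_atTop k] with n hn using hbound n k hn
  · refine HasCompactSupport.intro (isCompact_Icc (a := (0 : ℝ)) (b := 2)) fun y hy => ?_
    simp [hzero y hy]
  · simp [hzero y fun h => absurd h.1 (not_le.2 hy)]
  · have h1 : f n (x n) = a n := by
      simp [f, inv_mul_cancel₀ (hx n).1.ne', hφ1]
    exact h1.symm.le.trans ((hsum (x n)).le_tsum n fun m _ => hf0 m _)


/-- The module of smooth functions on `ℝ` vanishing on the open negative
half-line is not locally finitely generated at `0`: for every open neighbourhood `U` of `0`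
in `ℝ` and every finite family `g_1, …, g_k` of smooth functions on `ℝ` vanishing on
`(−∞,0)`, there exists a smooth compactly supported function `h` on `ℝ` vanishing on
`(−∞,0)` whose restriction to `U` cannot be written as `∑ j, c_j · g_j|_U` with
`c_1, …, c_k` smooth functions on `U`. -/
theorem stmt10 (U : Set ℝ) (hU : IsOpen U) (h0 : (0 : ℝ) ∈ U)
    (k : ℕ) (g : Fin k → ℝ → ℝ)
    (hg : ∀ j, ContDiff ℝ (⊤ : ℕ∞) (g j))
    (hg0 : ∀ j, ∀ x < (0 : ℝ), g j x = 0) :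
    ∃ h : ℝ → ℝ, ContDiff ℝ (⊤ : ℕ∞) h ∧ HasCompactSupport h ∧ (∀ x < (0 : ℝ), h x = 0) ∧
      ¬ ∃ c : Fin k → ℝ → ℝ, (∀ j, ContDiffOn ℝ (⊤ : ℕ∞) (c j) U) ∧
        ∀ x ∈ U, h x = ∑ j, c j x * g j x := by
  obtain ⟨C, hC1, hC⟩ := exists_contDiff_forall_pow_div_le
  have hCpos : ∀ n, 0 < C n := fun n => one_pos.trans_le (hC1 n)
  have hx : ∀ n : ℕ, ∃ x : ℝ, x ∈ Ioc (0 : ℝ) 1 ∧ x ≤ 1 / ((n : ℝ) + 1) ∧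
      ∀ j, ((n : ℝ) + 1) * |g j x| ≤ x ^ n / (C n * 2 ^ n) := by
    intro n
    choose K hK0 hK using fun j =>
      exists_abs_le_mul_pow_of_eq_zero_of_neg (n + 1) (g j) (hg j) (hg0 j)
    have hsmall : ∀ ε : ℝ, 0 < ε → ∀ᶠ x in 𝓝[>] (0 : ℝ), x ≤ ε := fun ε hε =>
      nhdsWithin_le_nhds (Iic_mem_nhds hε)
    have hj : ∀ᶠ x in 𝓝[>] (0 : ℝ), ∀ j, ((n : ℝ) + 1) * K j * (C n * 2 ^ n) * x ≤ 1 := by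
      refine eventually_all.2 fun j => ?_
      have ht : Tendsto (fun x : ℝ => ((n : ℝ) + 1) * K j * (C n * 2 ^ n) * x)
          (𝓝[>] (0 : ℝ)) (𝓝 0) := by
        have : Continuous fun x : ℝ => ((n : ℝ) + 1) * K j * (C n * 2 ^ n) * x := by fun_prop
        simpa using this.continuousAt.tendsto.mono_left (nhdsWithin_le_nhds (a := (0 : ℝ)))
      exact ht.eventually (Iic_mem_nhds one_pos)
    have hpos : ∀ᶠ x in 𝓝[>] (0 : ℝ), 0 < x := self_mem_nhdsWithin
    obtain ⟨x, hx0, hx1, hxn, hxj⟩ := (hpos.and ((hsmall 1 one_pos).and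
      ((hsmall (1 / ((n : ℝ) + 1)) (by positivity)).and hj))).exists
    refine ⟨x, ⟨hx0, hx1⟩, hxn, fun j => ?_⟩
    have hD : 0 < C n * 2 ^ n := mul_pos (hCpos n) (by positivity)
    rw [le_div_iff₀ hD]
    calc ((n : ℝ) + 1) * |g j x| * (C n * 2 ^ n)
        ≤ ((n : ℝ) + 1) * (K j * x ^ (n + 1)) * (C n * 2 ^ n) := by
          have := hK j x ⟨hx0.le, hx1⟩
          gcongr
      _ = (((n : ℝ) + 1) * K j * (C n * 2 ^ n) * x) * x ^ n := by ring
      _ ≤ 1 * x ^ n := by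
          have := hxj j
          gcongr
      _ = x ^ n := one_mul _
  choose x hx hxn hxg using hx
  obtain ⟨h, hh, hhc, hh0, hhx⟩ := hC x hx
  refine ⟨h, hh, hhc, hh0, ?_⟩
  rintro ⟨c, hc, hsum⟩
  have hxt : Tendsto x atTop (𝓝 0) :=
    squeeze_zero (fun n => (hx n).1.le) hxn tendsto_one_div_add_atTop_nhds_zero_nat
  have hct : Tendsto (fun n => ∑ j, |c j (x n)|) atTop (𝓝 (∑ j, |c j 0|)) :=
    tendsto_finsetSum _ fun j _ =>
      (((hc j).continuousOn.continuousAt (hU.mem_nhds h0)).tendsto.comp hxt).abs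
  have hlarge : ∀ᶠ n : ℕ in atTop, (∑ j, |c j 0|) + 1 < (n : ℝ) + 1 :=
    (tendsto_atTop_add_const_right _ _ tendsto_natCast_atTop_atTop).eventually_gt_atTop _
  obtain ⟨n, hnU, hnc, hn⟩ := ((hxt.eventually (hU.mem_nhds h0)).and
    ((hct.eventually (Iio_mem_nhds (lt_add_one _))).and hlarge)).exists
  have hpos : 0 < x n ^ n / (C n * 2 ^ n) :=
    div_pos (pow_pos (hx n).1 n) (mul_pos (hCpos n) (by positivity))
  have hle : ((n : ℝ) + 1) * h (x n) ≤
      (∑ j, |c j (x n)|) * (x n ^ n / (C n * 2 ^ n)) := by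
    rw [hsum _ hnU, Finset.mul_sum, Finset.sum_mul]
    refine Finset.sum_le_sum fun j _ => ?_
    calc ((n : ℝ) + 1) * (c j (x n) * g j (x n))
        ≤ ((n : ℝ) + 1) * (|c j (x n)| * |g j (x n)|) := by
          rw [← abs_mul]
          gcongr
          exact le_abs_self _
      _ = |c j (x n)| * (((n : ℝ) + 1) * |g j (x n)|) := by ring
      _ ≤ |c j (x n)| * (x n ^ n / (C n * 2 ^ n)) := by
          have := hxg n j
          gcongr
  have h1 : ((n : ℝ) + 1) * (x n ^ n / (C n * 2 ^ n)) ≤ ((n : ℝ) + 1) * h (x n) :=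
    mul_le_mul_of_nonneg_left (hhx n) (by positivity)
  exact absurd (le_of_mul_le_mul_right (h1.trans hle) hpos) (not_le.2 (hnc.trans hn))
end
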